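/- arXiv:1808.08621 — 2 statements merged into one kernel-verified Lean document; each statement's English description precedes it below -/
import Mathlib

section
/- Let M be a model of ZFC(∈₁) ∪ ZFC(∈₂). Then the binary relation on M defined by the formula φ(x,y) is the graph of a bijection F : M → M such that for all x, x' in M, x ∈₁ x' if and only if F(x) ∈₂ F(x'); i.e., φ defines an isomorphism between the reduct (M, ∈₁) and the reduct (M, ∈₂). -/
universe u

/-! ## Syntax of the first-order language `L = {∈₁, ∈₂}`

Formulas of the first-order language with two binary relation symbols `∈₁`
and `∈₂` (and equality), with variables indexed by `ℕ`. -/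
inductive Fml : Type
  | mem1 : ℕ → ℕ → Fml
  | mem2 : ℕ → ℕ → Fml
  | eq   : ℕ → ℕ → Fml
  | fal  : Fml
  | imp  : Fml → Fml → Fml
  | all  : ℕ → Fml → Fml

/-- Satisfaction of an `L`-formula in a structure `(M, e₁, e₂)` under a
valuation `v : ℕ → M` of the variables. -/
def Fml.Sat {M : Type u} (e₁ e₂ : M → M → Prop) : Fml → (ℕ → M) → Prop
  | .mem1 i j, v => e₁ (v i) (v j)
  | .mem2 i j, v => e₂ (v i) (v j)
  | .eq i j,   v => v i = v j
  | .fal,      _ => False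
  | .imp φ ψ,  v => φ.Sat e₁ e₂ v → ψ.Sat e₁ e₂ v
  | .all n φ,  v => ∀ a : M, φ.Sat e₁ e₂ (Function.update v n a)

/-! ## The ZFC axioms, with membership relation `e`

The Separation and Replacement schemas range over all `L`-formulas, i.e. the
formulas may mention both `∈₁` and `∈₂`; the remaining axioms only mention
the membership relation `e` itself. -/

def Extensionality {M : Type u} (e : M → M → Prop) : Prop :=
  ∀ x y : M, (∀ t, e t x ↔ e t y) → x = y

def Foundation {M : Type u} (e : M → M → Prop) : Prop :=
  ∀ x : M, (∃ t, e t x) → ∃ t, e t x ∧ ∀ s, e s t → ¬ e s x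

def Pairing {M : Type u} (e : M → M → Prop) : Prop :=
  ∀ x y : M, ∃ p : M, ∀ t, e t p ↔ (t = x ∨ t = y)

def UnionAx {M : Type u} (e : M → M → Prop) : Prop :=
  ∀ x : M, ∃ u : M, ∀ t, e t u ↔ ∃ s, e s x ∧ e t s

def PowerSetAx {M : Type u} (e : M → M → Prop) : Prop :=
  ∀ x : M, ∃ p : M, ∀ t, e t p ↔ ∀ s, e s t → e s x

def InfinityAx {M : Type u} (e : M → M → Prop) : Prop :=
  ∃ w : M, (∃ z, e z w ∧ ∀ t, ¬ e t z) ∧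
    ∀ t, e t w → ∃ s, e s w ∧ ∀ u, e u s ↔ (e u t ∨ u = t)

/-- The axiom of choice: every set of nonempty pairwise disjoint sets has a
choice set. -/
def ChoiceAx {M : Type u} (e : M → M → Prop) : Prop :=
  ∀ x : M, (∀ t, e t x → ∃ s, e s t) →
    (∀ t t', e t x → e t' x → t ≠ t' → ¬ ∃ s, e s t ∧ e s t') →
    ∃ c : M, ∀ t, e t x → ∃! s, e s t ∧ e s c

/-- The Separation Schema for the membership relation `e`, where the
formulas range over all `L`-formulas (interpreted with `∈₁ := e₁`,
`∈₂ := e₂`) and may use parameters (supplied by the valuation `v`);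
variable `0` is the variable being separated on. -/
def SeparationSchema {M : Type u} (e e₁ e₂ : M → M → Prop) : Prop :=
  ∀ (φ : Fml) (v : ℕ → M) (a : M), ∃ b : M,
    ∀ t : M, e t b ↔ (e t a ∧ φ.Sat e₁ e₂ (Function.update v 0 t))

/-- The Replacement Schema for the membership relation `e`, where the
formulas range over all `L`-formulas (interpreted with `∈₁ := e₁`,
`∈₂ := e₂`) and may use parameters; variables `0` and `1` are the
argument/value variables of the class function defined by `φ`. -/
def ReplacementSchema {M : Type u} (e e₁ e₂ : M → M → Prop) : Prop :=
  ∀ (φ : Fml) (v : ℕ → M) (a : M),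
    (∀ t, e t a → ∃! s, φ.Sat e₁ e₂ (Function.update (Function.update v 0 t) 1 s)) →
    ∃ b : M, ∀ t, e t a → ∀ s,
      φ.Sat e₁ e₂ (Function.update (Function.update v 0 t) 1 s) → e s b

/-- A model `(M, ∈₁, ∈₂)` of `ZFC(∈₁) ∪ ZFC(∈₂)`: the first-order ZFC axioms
hold for the membership relation `∈₁`, with the Separation and Replacement
schemas ranging over all formulas of the language `L = {∈₁, ∈₂}`, and
likewise for the membership relation `∈₂`. -/
structure ZFC2Model (M : Type u) : Type u where
  mem1 : M → M → Prop
  mem2 : M → M → Prop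
  ext1 : Extensionality mem1
  found1 : Foundation mem1
  pair1 : Pairing mem1
  union1 : UnionAx mem1
  power1 : PowerSetAx mem1
  infinity1 : InfinityAx mem1
  choice1 : ChoiceAx mem1
  sep1 : SeparationSchema mem1 mem1 mem2
  repl1 : ReplacementSchema mem1 mem1 mem2
  ext2 : Extensionality mem2
  found2 : Foundation mem2
  pair2 : Pairing mem2
  union2 : UnionAx mem2
  power2 : PowerSetAx mem2
  infinity2 : InfinityAx mem2
  choice2 : ChoiceAx mem2
  sep2 : SeparationSchema mem2 mem1 mem2
  repl2 : ReplacementSchema mem2 mem1 mem2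

/-! ## Defined notions, relative to a membership relation `e` -/

/-- `u` is a transitive set in the sense of `e`. -/
def IsTransSet {M : Type u} (e : M → M → Prop) (x : M) : Prop :=
  ∀ t, e t x → ∀ w, e w t → e w x

/-- `u` is the `e`-transitive closure `TC(x)` of `x`: the least transitive
set containing all `e`-elements of `x`. -/
def IsTC {M : Type u} (e : M → M → Prop) (x u : M) : Prop :=
  IsTransSet e u ∧ (∀ v, e v x → e v u) ∧
    ∀ v, IsTransSet e v → (∀ w, e w x → e w v) → ∀ w, e w u → e w v

/-- `s` is the singleton `{x}` in the sense of `e`. -/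
def IsSingleton {M : Type u} (e : M → M → Prop) (x s : M) : Prop :=
  ∀ t, e t s ↔ t = x

/-- `p` is the (Kuratowski) ordered pair `⟨a, b⟩ = {{a}, {a, b}}` in the
sense of `e`. -/
def IsOPair {M : Type u} (e : M → M → Prop) (a b p : M) : Prop :=
  ∃ sa pab : M, IsSingleton e a sa ∧ (∀ t, e t pab ↔ (t = a ∨ t = b)) ∧
    (∀ t, e t p ↔ (t = sa ∨ t = pab))

/-- `f(a) = b` in the sense of `e`: the ordered pair `⟨a, b⟩` is an
`e`-element of `f`. -/
def FunVal {M : Type u} (e : M → M → Prop) (f a b : M) : Prop :=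
  ∃ p, e p f ∧ IsOPair e a b p

/-- In the sense of `e`, the set `f` is a function with domain `d`. -/
def IsFuncOn {M : Type u} (e : M → M → Prop) (f d : M) : Prop :=
  (∀ p, e p f → ∃ a b, e a d ∧ IsOPair e a b p) ∧
  (∀ a, e a d → ∃ b, FunVal e f a b) ∧
  (∀ a b b', FunVal e f a b → FunVal e f a b' → b = b')

/-- `On(α)` in the sense of `e`: `α` is an ordinal, i.e. a transitive set of
transitive sets. -/
def IsOrd {M : Type u} (e : M → M → Prop) (α : M) : Prop :=
  IsTransSet e α ∧ ∀ t, e t α → IsTransSet e t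

/-- `v = V_α`, the `α`-th level of the cumulative hierarchy in the sense of
`e`: there is a function `g` (in the sense of `e`) with domain `α ∪ {α}`
such that `g(β) = { t : t ⊆ g(γ) for some γ ∈ β }` for every `β ∈ α ∪ {α}`,
and `v = g(α)`. -/
def IsVLevel {M : Type u} (e : M → M → Prop) (α v : M) : Prop :=
  ∃ g s : M, (∀ t, e t s ↔ (e t α ∨ t = α)) ∧ IsFuncOn e g s ∧
    (∀ β, e β s → ∀ gβ, FunVal e g β gβ → ∀ t,
      (e t gβ ↔ ∃ γ, e γ β ∧ ∃ gγ, FunVal e g γ gγ ∧ ∀ w, e w t → e w gγ)) ∧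
    FunVal e g α v

/-! ## The formulas `ψ(x, y, f)` and `φ(x, y)` -/

/-- The formula `ψ(x, y, f)` of Väänänen's paper, asserting that (i) in the
sense of `∈₁`, `f` is a function with domain `TC₁({x})`; (ii) `f` maps
`TC₁(x)` into `TC₂(y)`; (iii) `f` maps `TC₁(x)` onto `TC₂(y)`; (iv) for all
`t ∈₁ TC₁(x)` and `w ∈₁ TC₁({x})`, `t ∈₁ w ↔ f(t) ∈₂ f(w)`; and (v)
`f(x) = y`.  (Here `f` is applied in the sense of `∈₁`.) -/
def Psi {M : Type u} (e₁ e₂ : M → M → Prop) (x y f : M) : Prop :=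
  ∃ sx tcsx tcx tcy : M,
    IsSingleton e₁ x sx ∧ IsTC e₁ sx tcsx ∧ IsTC e₁ x tcx ∧ IsTC e₂ y tcy ∧
    -- (i)
    IsFuncOn e₁ f tcsx ∧
    -- (ii)
    (∀ t, e₁ t tcx → ∀ ft, FunVal e₁ f t ft → e₂ ft tcy) ∧
    -- (iii)
    (∀ t, e₂ t tcy → ∃ w, e₁ w tcx ∧ FunVal e₁ f w t) ∧
    -- (iv)
    (∀ t, e₁ t tcx → ∀ w, e₁ w tcsx → ∀ ft fw,
      FunVal e₁ f t ft → FunVal e₁ f w fw → (e₁ t w ↔ e₂ ft fw)) ∧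
    -- (v)
    FunVal e₁ f x y

/-- The formula `φ(x, y) := ∃f ψ(x, y, f)`. -/
def Phi {M : Type u} (e₁ e₂ : M → M → Prop) (x y : M) : Prop :=
  ∃ f, Psi e₁ e₂ x y f

/-! ## Definability with parameters -/

/-- `P` is definable (with parameters) by an `L`-formula. -/
def Dfn {M : Type u} (e₁ e₂ : M → M → Prop) (P : (ℕ → M) → Prop) : Prop :=
  (∃ k : ℕ, ∀ v w : ℕ → M, (∀ i < k, v i = w i) → (P v ↔ P w)) ∧
  ∃ (m : ℕ) (p : ℕ → M), ∀ σ ρ : ℕ → ℕ, ∃ φ : Fml, ∀ v : ℕ → M,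
    (∀ i < m, v (ρ i) = p i) → (φ.Sat e₁ e₂ v ↔ P (fun i => v (σ i)))

/-- A term: a variable or a constant. -/
def DT {M : Type u} (τ : (ℕ → M) → M) : Prop :=
  (∃ i, τ = fun v => v i) ∨ ∃ c, τ = fun _ => c

theorem DT.var {M : Type u} (i : ℕ) : DT (fun v : ℕ → M => v i) := Or.inl ⟨i, rfl⟩
theorem DT.const {M : Type u} (c : M) : DT (fun _ : ℕ → M => c) := Or.inr ⟨c, rfl⟩

section Definability
variable {M : Type u} {e₁ e₂ : M → M → Prop}

theorem Dfn.const [Nonempty M] (p : Prop) : Dfn e₁ e₂ (fun _ => p) := by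
  refine ⟨⟨0, fun _ _ _ => Iff.rfl⟩, 0, fun _ => Classical.arbitrary M, fun σ ρ => ?_⟩
  by_cases h : p
  · exact ⟨.imp .fal .fal, fun v _ => by simp [Fml.Sat, h]⟩
  · exact ⟨.fal, fun v _ => by simp [Fml.Sat, h]⟩

theorem Dfn.imp {P Q : (ℕ → M) → Prop} (hP : Dfn e₁ e₂ P) (hQ : Dfn e₁ e₂ Q) :
    Dfn e₁ e₂ (fun v => P v → Q v) := by
  obtain ⟨⟨k, hk⟩, m, p, h⟩ := hP
  obtain ⟨⟨k', hk'⟩, m', p', h'⟩ := hQ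
  refine ⟨⟨max k k', fun v w hvw => ?_⟩, m + m', fun i => if i < m then p i else p' (i - m),
    fun σ ρ => ?_⟩
  · show (P v → Q v) ↔ (P w → Q w)
    rw [hk v w (fun i hi => hvw i (by omega)), hk' v w (fun i hi => hvw i (by omega))]
  · obtain ⟨φ, hφ⟩ := h σ ρ
    obtain ⟨ψ, hψ⟩ := h' σ (fun i => ρ (m + i))
    refine ⟨.imp φ ψ, fun v hv => ?_⟩
    have h1 := hφ v (fun i hi => by
      have := hv i (by omega)
      simpa [hi] using this)
    have h2 := hψ v (fun i hi => by
      have := hv (m + i) (by omega)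
      simpa using this)
    simp only [Fml.Sat, h1, h2]

theorem Dfn.all {Q : (ℕ → M) → M → Prop}
    (h : Dfn e₁ e₂ (fun v => Q (fun i => v (i + 1)) (v 0))) :
    Dfn e₁ e₂ (fun v => ∀ a, Q v a) := by
  obtain ⟨⟨k, hk⟩, m, p, h⟩ := h
  have key : ∀ (v w : ℕ → M) (a : M), (∀ i < k, v i = w i) → (Q v a ↔ Q w a) := by
    intro v w a hvw
    have := hk (fun i => Nat.casesOn i a v) (fun i => Nat.casesOn i a w) (by
      intro i hi
      cases i with
      | zero => rfl
      | succ j => exact hvw j (by omega))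
    exact this
  refine ⟨⟨k, fun v w hvw => forall_congr' fun a => key v w a hvw⟩, m, p, fun σ ρ => ?_⟩
  obtain ⟨n, hn⟩ : ∃ n : ℕ, (∀ i < k, σ i ≠ n) ∧ ∀ i < m, ρ i ≠ n := by
    refine ⟨(∑ i ∈ Finset.range k, σ i) + (∑ i ∈ Finset.range m, ρ i) + 1, fun i hi => ?_,
      fun i hi => ?_⟩
    · have := Finset.single_le_sum (f := σ) (fun i _ => Nat.zero_le _) (Finset.mem_range.2 hi)
      omega
    · have := Finset.single_le_sum (f := ρ) (fun i _ => Nat.zero_le _) (Finset.mem_range.2 hi)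
      omega
  obtain ⟨φ, hφ⟩ := h (fun i => Nat.casesOn i n σ) ρ
  refine ⟨.all n φ, fun v hv => forall_congr' fun a => ?_⟩
  rw [hφ _ (fun i hi => by rw [Function.update_of_ne (hn.2 i hi)]; exact hv i hi)]
  show Q (fun i => Function.update v n a (σ i)) (Function.update v n a n) ↔ Q (fun i => v (σ i)) a
  rw [Function.update_self]
  exact key _ _ a (fun i hi => by rw [Function.update_of_ne (hn.1 i hi)])

theorem Dfn.congr {P Q : (ℕ → M) → Prop} (hP : Dfn e₁ e₂ P) (h : ∀ v, P v ↔ Q v) :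
    Dfn e₁ e₂ Q := by
  have : P = Q := funext fun v => propext (h v)
  exact this ▸ hP

theorem Dfn.not [Nonempty M] {P : (ℕ → M) → Prop} (hP : Dfn e₁ e₂ P) :
    Dfn e₁ e₂ (fun v => ¬ P v) := hP.imp (Dfn.const False)

theorem Dfn.and [Nonempty M] {P Q : (ℕ → M) → Prop} (hP : Dfn e₁ e₂ P) (hQ : Dfn e₁ e₂ Q) :
    Dfn e₁ e₂ (fun v => P v ∧ Q v) :=
  (hP.imp hQ.not).not.congr fun v => by tauto

theorem Dfn.or [Nonempty M] {P Q : (ℕ → M) → Prop} (hP : Dfn e₁ e₂ P) (hQ : Dfn e₁ e₂ Q) :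
    Dfn e₁ e₂ (fun v => P v ∨ Q v) :=
  (hP.not.imp hQ).congr fun v => by tauto

theorem Dfn.iff [Nonempty M] {P Q : (ℕ → M) → Prop} (hP : Dfn e₁ e₂ P) (hQ : Dfn e₁ e₂ Q) :
    Dfn e₁ e₂ (fun v => P v ↔ Q v) :=
  ((hP.imp hQ).and (hQ.imp hP)).congr fun v => by tauto

theorem Dfn.ex [Nonempty M] {Q : (ℕ → M) → M → Prop}
    (h : Dfn e₁ e₂ (fun v => Q (fun i => v (i + 1)) (v 0))) :
    Dfn e₁ e₂ (fun v => ∃ a, Q v a) :=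
  (Dfn.all (Q := fun v a => ¬ Q v a) h.not).not.congr fun v => by simp

theorem Dfn.subst {P : (ℕ → M) → Prop} (hP : Dfn e₁ e₂ P) (τ : ℕ → (ℕ → M) → M)
    (hτ : ∀ i, DT (τ i)) : Dfn e₁ e₂ (fun v => P (fun i => τ i v)) := by
  classical
  obtain ⟨⟨k, hk⟩, m, p, h⟩ := hP
  -- for each index: a bit, a variable, a constant
  have hτ' : ∀ i, ∃ (b : Bool) (j : ℕ) (c : M), ∀ v, τ i v = if b then v j else c := by
    intro i
    rcases hτ i with ⟨j, hj⟩ | ⟨c, hc⟩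
    · exact ⟨true, j, p 0, fun v => by simp [hj]⟩
    · exact ⟨false, 0, c, fun v => by simp [hc]⟩
  choose b j c hbc using hτ'
  refine ⟨⟨(∑ i ∈ Finset.range k, j i) + 1, fun v w hvw => hk _ _ fun i hi => ?_⟩, m + k,
    fun i => if i < m then p i else c (i - m), fun σ ρ => ?_⟩
  · have := Finset.single_le_sum (f := j) (fun i _ => Nat.zero_le _) (Finset.mem_range.2 hi)
    rw [hbc, hbc, hvw (j i) (by omega)]
  · obtain ⟨φ, hφ⟩ := h (fun i => if b i then σ (j i) else ρ (m + i)) ρ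
    refine ⟨φ, fun v hv => ?_⟩
    rw [hφ v (fun i hi => by
      have := hv i (by omega)
      simpa [hi] using this)]
    refine hk _ _ fun i hi => ?_
    rw [hbc]
    have := hv (m + i) (by omega)
    cases hb : b i <;> simp_all

theorem Dfn.mem1' [Nonempty M] : Dfn e₁ e₂ (fun v => e₁ (v 0) (v 1)) :=
  ⟨⟨2, fun v w h => by simp only [h 0 (by omega), h 1 (by omega)]⟩, 0, fun _ => Classical.arbitrary M,
    fun σ _ => ⟨.mem1 (σ 0) (σ 1), fun _ _ => Iff.rfl⟩⟩

theorem Dfn.mem2' [Nonempty M] : Dfn e₁ e₂ (fun v => e₂ (v 0) (v 1)) :=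
  ⟨⟨2, fun v w h => by simp only [h 0 (by omega), h 1 (by omega)]⟩, 0, fun _ => Classical.arbitrary M,
    fun σ _ => ⟨.mem2 (σ 0) (σ 1), fun _ _ => Iff.rfl⟩⟩

theorem Dfn.eq' [Nonempty M] : Dfn e₁ e₂ (fun v => v 0 = v 1) :=
  ⟨⟨2, fun v w h => by simp only [h 0 (by omega), h 1 (by omega)]⟩, 0, fun _ => Classical.arbitrary M,
    fun σ _ => ⟨.eq (σ 0) (σ 1), fun _ _ => Iff.rfl⟩⟩

/-- Definable classes. -/
class DR1 (e₁ e₂ : M → M → Prop) (A : M → Prop) : Prop where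
  d : Dfn e₁ e₂ (fun v => A (v 0))

/-- Definable binary relations. -/
class DR2 (e₁ e₂ : M → M → Prop) (R : M → M → Prop) : Prop where
  d : Dfn e₁ e₂ (fun v => R (v 0) (v 1))

/-- Definable ternary relations. -/
class DR3 (e₁ e₂ : M → M → Prop) (R : M → M → M → Prop) : Prop where
  d : Dfn e₁ e₂ (fun v => R (v 0) (v 1) (v 2))

theorem Dfn.app1 {A : M → Prop} [h : DR1 e₁ e₂ A] {τ : (ℕ → M) → M} (hτ : DT τ) :
    Dfn e₁ e₂ (fun v => A (τ v)) := h.d.subst (fun _ => τ) (fun _ => hτ)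

theorem Dfn.app2 {A : M → M → Prop} [h : DR2 e₁ e₂ A] {τ σ : (ℕ → M) → M} (hτ : DT τ)
    (hσ : DT σ) : Dfn e₁ e₂ (fun v => A (τ v) (σ v)) :=
  h.d.subst (fun i => if i = 0 then τ else σ) (fun i => by split_ifs <;> assumption)

theorem Dfn.app3 {A : M → M → M → Prop} [h : DR3 e₁ e₂ A] {τ σ υ : (ℕ → M) → M} (hτ : DT τ)
    (hσ : DT σ) (hυ : DT υ) : Dfn e₁ e₂ (fun v => A (τ v) (σ v) (υ v)) :=
  h.d.subst (fun i => if i = 0 then τ else if i = 1 then σ else υ)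
    (fun i => by split_ifs <;> assumption)

theorem Dfn.eq [Nonempty M] {τ σ : (ℕ → M) → M} (hτ : DT τ)
    (hσ : DT σ) : Dfn e₁ e₂ (fun v => τ v = σ v) :=
  haveI : DR2 e₁ e₂ (fun a b : M => a = b) := ⟨Dfn.eq'⟩
  Dfn.app2 (A := fun a b : M => a = b) hτ hσ

end Definability

/-- Proves definability goals by its default argument. -/
theorem dfn_auto {P : Prop} (h : P := by
  repeat' first
    | with_reducible exact DT.var _
    | with_reducible exact DT.const _
    | with_reducible exact Dfn.const _
    | with_reducible apply Dfn.imp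
    | with_reducible apply Dfn.not
    | with_reducible apply Dfn.and
    | with_reducible apply Dfn.or
    | with_reducible apply Dfn.iff
    | with_reducible apply Dfn.all
    | with_reducible apply Dfn.ex
    | with_reducible apply Dfn.eq
    | with_reducible apply Dfn.app3
    | with_reducible apply Dfn.app2
    | with_reducible apply Dfn.app1) : P := h

/-- One membership relation `e` of a model, with schemas for definable classes. -/
class ZM {M : Type u} (e₁ e₂ e : M → M → Prop) : Prop where
  ne : Nonempty M
  ext : Extensionality e
  found : Foundation e
  pair : Pairing e
  union : UnionAx e
  power : PowerSetAx e
  inf : InfinityAx e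
  sep : ∀ A : M → Prop, Dfn e₁ e₂ (fun v => A (v 0)) → ∀ a, ∃ b, ∀ t, e t b ↔ e t a ∧ A t
  repl : ∀ R : M → M → Prop, Dfn e₁ e₂ (fun v => R (v 0) (v 1)) → ∀ a,
    (∀ t, e t a → ∃! s, R t s) → ∃ b, ∀ t, e t a → ∀ s, R t s → e s b
  dfn : Dfn e₁ e₂ (fun v => e (v 0) (v 1))

instance {M : Type u} {e₁ e₂ e : M → M → Prop} [H : ZM e₁ e₂ e] : DR2 e₁ e₂ e := ⟨H.dfn⟩

theorem sep_of {M : Type u} {e e₁ e₂ : M → M → Prop} (h : SeparationSchema e e₁ e₂)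
    (A : M → Prop) (hA : Dfn e₁ e₂ (fun v => A (v 0))) (a : M) :
    ∃ b, ∀ t, e t b ↔ e t a ∧ A t := by
  obtain ⟨_, m, p, hp⟩ := hA
  obtain ⟨φ, hφ⟩ := hp (fun _ => 0) (fun i => i + 1)
  obtain ⟨b, hb⟩ := h φ (fun i => p (i - 1)) a
  refine ⟨b, fun t => ?_⟩
  rw [hb, hφ _ (fun i _ => by simp)]
  simp

theorem repl_of {M : Type u} {e e₁ e₂ : M → M → Prop} (h : ReplacementSchema e e₁ e₂)
    (R : M → M → Prop) (hR : Dfn e₁ e₂ (fun v => R (v 0) (v 1))) (a : M)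
    (hf : ∀ t, e t a → ∃! s, R t s) : ∃ b, ∀ t, e t a → ∀ s, R t s → e s b := by
  obtain ⟨_, m, p, hp⟩ := hR
  obtain ⟨φ, hφ⟩ := hp (fun i => i) (fun i => i + 2)
  have key : ∀ t s, φ.Sat e₁ e₂ (Function.update (Function.update (fun i => p (i - 2)) 0 t) 1 s)
      ↔ R t s := by
    intro t s
    rw [hφ _ (fun i _ => by simp [Function.update])]
    simp
  obtain ⟨b, hb⟩ := h φ (fun i => p (i - 2)) a (fun t ht => by simpa only [key] using hf t ht)
  exact ⟨b, fun t ht s hs => hb t ht s ((key t s).2 hs)⟩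

theorem ZFC2Model.zm1 {M : Type u} (Z : ZFC2Model M) : ZM Z.mem1 Z.mem2 Z.mem1 :=
  haveI : Nonempty M := ⟨Z.infinity1.choose⟩
  ⟨this, Z.ext1, Z.found1, Z.pair1, Z.union1, Z.power1, Z.infinity1, sep_of Z.sep1,
    repl_of Z.repl1, Dfn.mem1'⟩

theorem ZFC2Model.zm2 {M : Type u} (Z : ZFC2Model M) : ZM Z.mem1 Z.mem2 Z.mem2 :=
  haveI : Nonempty M := ⟨Z.infinity1.choose⟩
  ⟨this, Z.ext2, Z.found2, Z.pair2, Z.union2, Z.power2, Z.infinity2, sep_of Z.sep2,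
    repl_of Z.repl2, Dfn.mem2'⟩

section Inst
variable {M : Type u} {e₁ e₂ e : M → M → Prop} [Nonempty M]

instance [DR2 e₁ e₂ e] : DR1 e₁ e₂ (IsTransSet e) := ⟨by unfold IsTransSet; exact dfn_auto⟩
instance [DR2 e₁ e₂ e] : DR2 e₁ e₂ (IsTC e) := ⟨by unfold IsTC; exact dfn_auto⟩
instance [DR2 e₁ e₂ e] : DR2 e₁ e₂ (IsSingleton e) := ⟨by unfold IsSingleton; exact dfn_auto⟩
instance [DR2 e₁ e₂ e] : DR3 e₁ e₂ (IsOPair e) := ⟨by unfold IsOPair; exact dfn_auto⟩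
instance [DR2 e₁ e₂ e] : DR3 e₁ e₂ (FunVal e) := ⟨by unfold FunVal; exact dfn_auto⟩
instance [DR2 e₁ e₂ e] : DR2 e₁ e₂ (IsFuncOn e) := ⟨by unfold IsFuncOn; exact dfn_auto⟩
instance [DR2 e₁ e₂ e₁] [DR2 e₁ e₂ e₂] : DR3 e₁ e₂ (Psi e₁ e₂) :=
  ⟨by unfold Psi; exact dfn_auto⟩
instance [DR2 e₁ e₂ e₁] [DR2 e₁ e₂ e₂] : DR2 e₁ e₂ (Phi e₁ e₂) :=
  ⟨by unfold Phi; exact dfn_auto⟩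

end Inst

/-! ## Basic set theory for one membership relation -/

section Basic
variable {M : Type u} {e₁ e₂ e : M → M → Prop}

theorem ZM.img (H : ZM e₁ e₂ e) (R : M → M → Prop) (hR : DR2 e₁ e₂ R) (a : M)
    (hf : ∀ t, e t a → ∀ s s', R t s → R t s' → s = s') :
    ∃ b, ∀ s, e s b ↔ ∃ t, e t a ∧ R t s := by
  have := H.ne
  obtain ⟨a', ha'⟩ := H.sep (fun t => ∃ s, R t s) dfn_auto a
  obtain ⟨b0, hb0⟩ := H.repl R hR.d a' (fun t ht => by
    obtain ⟨h1, s, hs⟩ := (ha' t).1 ht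
    exact ⟨s, hs, fun s' hs' => hf t h1 s' s hs' hs⟩)
  obtain ⟨b, hb⟩ := H.sep (fun s => ∃ t, e t a ∧ R t s) dfn_auto b0
  refine ⟨b, fun s => ?_⟩
  rw [hb]
  refine ⟨fun h => h.2, fun h => ⟨?_, h⟩⟩
  obtain ⟨t, ht, hs⟩ := h
  exact hb0 t ((ha' t).2 ⟨ht, s, hs⟩) s hs

theorem ZM.adj (H : ZM e₁ e₂ e) (g p : M) : ∃ g', ∀ t, e t g' ↔ e t g ∨ t = p := by
  obtain ⟨s, hs⟩ := H.pair p p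
  obtain ⟨q, hq⟩ := H.pair g s
  obtain ⟨u, hu⟩ := H.union q
  refine ⟨u, fun t => ?_⟩
  rw [hu]
  constructor
  · rintro ⟨x, hx, ht⟩
    rcases (hq x).1 hx with rfl | rfl
    · exact Or.inl ht
    · exact Or.inr (by simpa using (hs t).1 ht)
  · rintro (h | rfl)
    · exact ⟨g, (hq g).2 (Or.inl rfl), h⟩
    · exact ⟨s, (hq s).2 (Or.inr rfl), (hs t).2 (Or.inl rfl)⟩

theorem ZM.no2 (H : ZM e₁ e₂ e) {a b : M} (hab : e a b) (hba : e b a) : False := by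
  obtain ⟨p, hp⟩ := H.pair a b
  obtain ⟨t, ht, hm⟩ := H.found p ⟨a, (hp a).2 (Or.inl rfl)⟩
  rcases (hp t).1 ht with rfl | rfl
  · exact hm b hba ((hp b).2 (Or.inr rfl))
  · exact hm a hab ((hp a).2 (Or.inl rfl))

theorem ZM.irrefl (H : ZM e₁ e₂ e) {a : M} (h : e a a) : False := H.no2 h h

theorem ZM.opair (H : ZM e₁ e₂ e) (a b : M) : ∃ p, IsOPair e a b p := by
  obtain ⟨s, hs⟩ := H.pair a a
  obtain ⟨q, hq⟩ := H.pair a b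
  obtain ⟨p, hp⟩ := H.pair s q
  exact ⟨p, s, q, fun t => by simpa using hs t, hq, hp⟩

theorem ZM.opair_uniq (H : ZM e₁ e₂ e) {a b p p' : M} (h : IsOPair e a b p)
    (h' : IsOPair e a b p') : p = p' := by
  obtain ⟨s, q, hs, hq, hp⟩ := h
  obtain ⟨s', q', hs', hq', hp'⟩ := h'
  have h1 : s = s' := H.ext _ _ fun t => by rw [hs t, hs' t]
  have h2 : q = q' := H.ext _ _ fun t => by rw [hq t, hq' t]
  subst h1 h2
  exact H.ext _ _ fun t => by rw [hp, hp']

theorem opair_inj {a b a' b' p : M} (h : IsOPair e a b p)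
    (h' : IsOPair e a' b' p) : a = a' ∧ b = b' := by
  obtain ⟨s, q, hs, hq, hp⟩ := h
  obtain ⟨s', q', hs', hq', hp'⟩ := h'
  unfold IsSingleton at hs hs'
  have ha : a = a' := by
    rcases (hp' s).1 ((hp s).2 (Or.inl rfl)) with h | h
    · subst h
      exact (hs' a).1 ((hs a).2 rfl)
    · subst h
      exact ((hs a').1 ((hq' a').2 (Or.inl rfl))).symm
  subst ha
  refine ⟨rfl, ?_⟩
  have h1 : b = a ∨ b = b' := by
    rcases (hp' q).1 ((hp q).2 (Or.inr rfl)) with h | h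
    · subst h
      exact Or.inl ((hs' b).1 ((hq b).2 (Or.inr rfl)))
    · subst h
      exact (hq' b).1 ((hq b).2 (Or.inr rfl))
  have h2 : b' = a ∨ b' = b := by
    rcases (hp q').1 ((hp' q').2 (Or.inr rfl)) with h | h
    · subst h
      exact Or.inl ((hs b').1 ((hq' b').2 (Or.inr rfl)))
    · subst h
      exact (hq b').1 ((hq' b').2 (Or.inr rfl))
  rcases h1 with h1 | h1
  · rcases h2 with h2 | h2
    · rw [h1, h2]
    · exact h2.symm
  · exact h1

/-- Every set has a transitive superset. -/
theorem ZM.trans_superset (H : ZM e₁ e₂ e) (x : M) :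
    ∃ u, IsTransSet e u ∧ ∀ t, e t x → e t u := by
  have := H.ne
  obtain ⟨w, ⟨z, hzw, hz⟩, hw⟩ := H.inf
  let Ap : M → Prop := fun g => ∀ k u, FunVal e g k u → e k w ∧ ((k = z ∧ u = x) ∨
    ∃ k' u', FunVal e g k' u' ∧ (∀ t, e t k ↔ (e t k' ∨ t = k')) ∧
      (∀ t, e t u ↔ ∃ s, e s u' ∧ e t s))
  let R : M → M → Prop := fun n u => ∃ g, Ap g ∧ FunVal e g n u
  have : DR1 e₁ e₂ Ap := ⟨by simp only [Ap]; exact dfn_auto⟩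
  have hR : DR2 e₁ e₂ R := ⟨by simp only [R]; exact dfn_auto⟩
  have ext_step : ∀ g k u, Ap g → e k w → ((k = z ∧ u = x) ∨
      ∃ k' u', FunVal e g k' u' ∧ (∀ t, e t k ↔ (e t k' ∨ t = k')) ∧
      (∀ t, e t u ↔ ∃ s, e s u' ∧ e t s)) → R k u := by
    intro g k u hg hk hu
    obtain ⟨p, hp⟩ := H.opair k u
    obtain ⟨g', hg'⟩ := H.adj g p
    have mono : ∀ a b, FunVal e g a b → FunVal e g' a b := fun a b ⟨q, hq, hab⟩ =>
      ⟨q, (hg' q).2 (Or.inl hq), hab⟩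
    refine ⟨g', ?_, p, (hg' p).2 (Or.inr rfl), hp⟩
    rintro a b ⟨q, hq, hab⟩
    rcases (hg' q).1 hq with hq | rfl
    · obtain ⟨h1, h2⟩ := hg a b ⟨q, hq, hab⟩
      refine ⟨h1, h2.imp_right ?_⟩
      rintro ⟨k', u', h3, h4⟩
      exact ⟨k', u', mono _ _ h3, h4⟩
    · obtain ⟨rfl, rfl⟩ := opair_inj hab hp
      refine ⟨hk, hu.imp_right ?_⟩
      rintro ⟨k', u', h3, h4⟩
      exact ⟨k', u', mono _ _ h3, h4⟩
  have hbase : R z x := by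
    obtain ⟨g, hg⟩ := H.sep (fun _ => False) dfn_auto w
    refine ext_step g z x ?_ hzw (Or.inl ⟨rfl, rfl⟩)
    rintro k u ⟨p, hp, _⟩
    exact ((hg p).1 hp).2.elim
  have hinv : ∀ k u, R k u → e k w ∧ ((k = z ∧ u = x) ∨
      ∃ k' u', R k' u' ∧ (∀ t, e t k ↔ (e t k' ∨ t = k')) ∧
      (∀ t, e t u ↔ ∃ s, e s u' ∧ e t s)) := by
    rintro k u ⟨g, hg, hku⟩
    obtain ⟨h1, h2⟩ := hg k u hku
    refine ⟨h1, h2.imp_right ?_⟩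
    rintro ⟨k', u', h3, h4⟩
    exact ⟨k', u', ⟨g, hg, h3⟩, h4⟩
  have hstep : ∀ k u k' u', R k u → e k' w → (∀ t, e t k' ↔ (e t k ∨ t = k)) →
      (∀ t, e t u' ↔ ∃ s, e s u ∧ e t s) → R k' u' := by
    rintro k u k' u' ⟨g, hg, hku⟩ hk' h1 h2
    exact ext_step g k' u' hg hk' (Or.inr ⟨k, u, hku, h1, h2⟩)
  have huniq : ∀ k, e k w → ∀ u u', R k u → R k u' → u = u' := by
    obtain ⟨b, hb⟩ := H.sep (fun k => ¬ ∀ u u', R k u → R k u' → u = u') dfn_auto w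
    by_contra hcon
    push Not at hcon
    obtain ⟨k, hk, u, u', h1, h2, h3⟩ := hcon
    obtain ⟨m, hm, hmin⟩ := H.found b ⟨k, (hb k).2 ⟨hk, fun h => h3 (h u u' h1 h2)⟩⟩
    refine ((hb m).1 hm).2 ?_
    intro u u' hu hu'
    obtain ⟨_, h1⟩ := hinv m u hu
    obtain ⟨_, h2⟩ := hinv m u' hu'
    rcases h1 with ⟨rfl, rfl⟩ | ⟨k1, u1, hR1, hk1, hu1⟩
    · rcases h2 with ⟨_, rfl⟩ | ⟨k2, u2, hR2, hk2, hu2⟩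
      · rfl
      · exact (hz k2 ((hk2 k2).2 (Or.inr rfl))).elim
    · rcases h2 with ⟨rfl, rfl⟩ | ⟨k2, u2, hR2, hk2, hu2⟩
      · exact (hz k1 ((hk1 k1).2 (Or.inr rfl))).elim
      · have hk12 : k1 = k2 := by
          rcases (hk2 k1).1 ((hk1 k1).2 (Or.inr rfl)) with h | h
          · rcases (hk1 k2).1 ((hk2 k2).2 (Or.inr rfl)) with h' | h'
            · exact (H.no2 h h').elim
            · exact h'.symm
          · exact h
        subst hk12
        have hk1m : e k1 m := (hk1 k1).2 (Or.inr rfl)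
        have hu12 : u1 = u2 := by
          by_contra hne
          exact hmin k1 hk1m ((hb k1).2 ⟨(hinv _ _ hR1).1, fun h => hne (h u1 u2 hR1 hR2)⟩)
        subst hu12
        exact H.ext _ _ fun t => by rw [hu1, hu2]
  obtain ⟨c, hc⟩ := H.img R hR w huniq
  obtain ⟨U, hU⟩ := H.union c
  refine ⟨U, ?_, fun t ht => (hU t).2 ⟨x, (hc x).2 ⟨z, hzw, hbase⟩, ht⟩⟩
  intro t ht s hs
  obtain ⟨u, hu, htu⟩ := (hU t).1 ht
  obtain ⟨n, hn, hnu⟩ := (hc u).1 hu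
  obtain ⟨n', hn', hnn⟩ := hw n hn
  obtain ⟨u', hu'⟩ := H.union u
  exact (hU s).2 ⟨u', (hc u').2 ⟨n', hn', hstep n u n' u' hnu hn' hnn hu'⟩,
    (hu' s).2 ⟨t, htu, hs⟩⟩

theorem ZM.class_min (H : ZM e₁ e₂ e) (A : M → Prop) (hA : DR1 e₁ e₂ A) {x : M} (hx : A x) :
    ∃ m, A m ∧ ∀ t, e t m → ¬ A t := by
  obtain ⟨u, hu, hxu⟩ := H.trans_superset x
  obtain ⟨c, hc⟩ := H.sep A hA.d u
  by_cases h : ∃ t, e t c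
  · obtain ⟨m, hm, hmin⟩ := H.found c h
    obtain ⟨h1, h2⟩ := (hc m).1 hm
    exact ⟨m, h2, fun t ht hAt => hmin t ht ((hc t).2 ⟨hu m h1 t ht, hAt⟩)⟩
  · exact ⟨x, hx, fun t ht hAt => h ⟨t, (hc t).2 ⟨hxu t ht, hAt⟩⟩⟩

theorem ZM.ind (H : ZM e₁ e₂ e) (A : M → Prop) (hA : DR1 e₁ e₂ A)
    (h : ∀ x, (∀ t, e t x → A t) → A x) (x : M) : A x := by
  have := H.ne
  by_contra hx
  obtain ⟨m, hm, hmin⟩ := H.class_min (fun x => ¬ A x) ⟨dfn_auto⟩ hx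
  exact hm (h m fun t ht => not_not.1 (hmin t ht))

theorem ZM.exTC (H : ZM e₁ e₂ e) (x : M) : ∃ u, IsTC e x u := by
  have := H.ne
  obtain ⟨u, hu, hxu⟩ := H.trans_superset x
  obtain ⟨c, hc⟩ := H.sep (fun t => ∀ v, IsTransSet e v → (∀ w, e w x → e w v) → e t v) dfn_auto u
  refine ⟨c, ?_, ?_, ?_⟩
  · intro t ht w hw
    obtain ⟨h1, h2⟩ := (hc t).1 ht
    exact (hc w).2 ⟨hu t h1 w hw, fun v hv hxv => hv t (h2 v hv hxv) w hw⟩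
  · exact fun v hv => (hc v).2 ⟨hxu v hv, fun _ _ h => h v hv⟩
  · exact fun v hv hxv w hw => ((hc w).1 hw).2 v hv hxv

theorem ZM.tc_ind (H : ZM e₁ e₂ e) {x u : M} (h : IsTC e x u) (A : M → Prop)
    (hA : DR1 e₁ e₂ A) (h0 : ∀ t, e t x → A t)
    (h1 : ∀ t, e t u → A t → ∀ w, e w t → A w) : ∀ t, e t u → A t := by
  obtain ⟨c, hc⟩ := H.sep A hA.d u
  intro t ht
  refine ((hc t).1 (h.2.2 c ?_ ?_ t ht)).2
  · intro a ha b hb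
    obtain ⟨h2, h3⟩ := (hc a).1 ha
    exact (hc b).2 ⟨h.1 a h2 b hb, h1 a h2 h3 b hb⟩
  · exact fun w hw => (hc w).2 ⟨h.2.1 w hw, h0 w hw⟩

theorem ZM.tc_sing (H : ZM e₁ e₂ e) {x sx u u' : M} (hs : IsSingleton e x sx)
    (h : IsTC e x u) (h' : IsTC e sx u') (t : M) : e t u' ↔ e t u ∨ t = x := by
  have hx : e x u' := h'.2.1 x ((hs x).2 rfl)
  constructor
  · obtain ⟨c, hc⟩ := H.adj u x
    intro ht
    refine (hc t).1 (h'.2.2 c ?_ ?_ t ht)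
    · intro a ha b hb
      rcases (hc a).1 ha with ha | rfl
      · exact (hc b).2 (Or.inl (h.1 a ha b hb))
      · exact (hc b).2 (Or.inl (h.2.1 b hb))
    · exact fun w hw => (hc w).2 (Or.inr ((hs w).1 hw))
  · rintro (ht | rfl)
    · exact h.2.2 u' h'.1 (fun w hw => h'.1 x hx w hw) t ht
    · exact hx

theorem ZM.exSing (H : ZM e₁ e₂ e) (x : M) : ∃ s, IsSingleton e x s := by
  obtain ⟨s, hs⟩ := H.pair x x
  exact ⟨s, fun t => by simpa using hs t⟩

/-- The potentiation of a set. -/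
theorem ZM.pot (H : ZM e₁ e₂ e) (a : M) :
    ∃ b, ∀ x, e x b ↔ ∃ c, e c a ∧ ∀ w, e w x → e w c := by
  have := H.ne
  obtain ⟨u, hu⟩ := H.union a
  obtain ⟨p, hp⟩ := H.power u
  obtain ⟨b, hb⟩ := H.sep (fun x => ∃ c, e c a ∧ ∀ w, e w x → e w c) dfn_auto p
  refine ⟨b, fun x => ?_⟩
  rw [hb, and_iff_right_of_imp]
  rintro ⟨c, hc, hxc⟩
  exact (hp x).2 fun s hs => (hu s).2 ⟨c, hc, hxc s hs⟩

/-! ### Levels of the cumulative hierarchy -/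

/-- Histories, in the sense of Button's level theory. -/
def IsHist (e : M → M → Prop) (h : M) : Prop :=
  ∀ x, e x h → ∀ a, e a x ↔ ∃ c, e c x ∧ e c h ∧ ∀ w, e w a → e w c

/-- Levels of the cumulative hierarchy. -/
def IsLev (e : M → M → Prop) (s : M) : Prop :=
  ∃ h, IsHist e h ∧ ∀ a, e a s ↔ ∃ c, e c h ∧ ∀ w, e w a → e w c

/-- `L` is the least level including `t`. -/
def IsLL (e : M → M → Prop) (t L : M) : Prop :=
  IsLev e L ∧ (∀ w, e w t → e w L) ∧
    ∀ L', IsLev e L' → e L' L → ¬ ∀ w, e w t → e w L'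

instance [Nonempty M] [DR2 e₁ e₂ e] : DR1 e₁ e₂ (IsHist e) := ⟨by unfold IsHist; exact dfn_auto⟩
instance [Nonempty M] [DR2 e₁ e₂ e] : DR1 e₁ e₂ (IsLev e) := ⟨by unfold IsLev; exact dfn_auto⟩
instance [Nonempty M] [DR2 e₁ e₂ e] : DR2 e₁ e₂ (IsLL e) := ⟨by unfold IsLL; exact dfn_auto⟩

theorem ZM.hist_trans (H : ZM e₁ e₂ e) {h : M} (hh : IsHist e h) :
    ∀ c, e c h → IsTransSet e c := by
  have := H.ne
  refine H.ind (fun c => e c h → IsTransSet e c) ⟨dfn_auto⟩ ?_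
  intro c ih hc a ha y hy
  obtain ⟨x, hx, hxh, hax⟩ := (hh c hc a).1 ha
  exact (hh c hc y).2 ⟨x, hx, hxh, ih x hx hxh y (hax y hy)⟩

theorem ZM.lev_trans (H : ZM e₁ e₂ e) {s : M} (hs : IsLev e s) : IsTransSet e s := by
  obtain ⟨h, hh, hs⟩ := hs
  intro a ha y hy
  obtain ⟨c, hc, hac⟩ := (hs a).1 ha
  exact (hs y).2 ⟨c, hc, H.hist_trans hh c hc y (hac y hy)⟩

theorem lev_pot {s a b : M} (hs : IsLev e s) (ha : e a s) (hb : ∀ w, e w b → e w a) :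
    e b s := by
  obtain ⟨h, hh, hs⟩ := hs
  obtain ⟨c, hc, hac⟩ := (hs a).1 ha
  exact (hs b).2 ⟨c, hc, fun w hw => hac w (hb w hw)⟩

theorem ZM.hist_lev (H : ZM e₁ e₂ e) {h c : M} (hh : IsHist e h) (hc : e c h) : IsLev e c := by
  have := H.ne
  obtain ⟨k, hk⟩ := H.sep (fun t => e t h) dfn_auto c
  refine ⟨k, ?_, fun a => ?_⟩
  · intro x hx a
    obtain ⟨hxc, hxh⟩ := (hk x).1 hx
    rw [hh x hxh a]
    constructor
    · rintro ⟨z, hz, hzh, haz⟩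
      exact ⟨z, hz, (hk z).2 ⟨H.hist_trans hh c hc x hxc z hz, hzh⟩, haz⟩
    · rintro ⟨z, hz, hzk, haz⟩
      exact ⟨z, hz, ((hk z).1 hzk).2, haz⟩
  · rw [hh c hc a]
    simp only [hk, and_assoc]

theorem ZM.lev_mem (H : ZM e₁ e₂ e) {s a : M} (hs : IsLev e s) (ha : e a s) :
    ∃ r, IsLev e r ∧ e r s ∧ ∀ w, e w a → e w r := by
  obtain ⟨h, hh, hs⟩ := hs
  obtain ⟨c, hc, hac⟩ := (hs a).1 ha
  exact ⟨c, H.hist_lev hh hc, (hs c).2 ⟨c, hc, fun _ h => h⟩, hac⟩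

theorem ZM.lev_cmp (H : ZM e₁ e₂ e) : ∀ s, IsLev e s → ∀ t, IsLev e t →
    e s t ∨ s = t ∨ e t s := by
  have := H.ne
  refine H.ind (fun s => IsLev e s → ∀ t, IsLev e t → e s t ∨ s = t ∨ e t s) ⟨dfn_auto⟩ ?_
  intro s ihs hs
  refine H.ind (fun t => IsLev e t → e s t ∨ s = t ∨ e t s) ⟨dfn_auto⟩ ?_
  intro t iht ht
  by_contra hcon
  push Not at hcon
  obtain ⟨h1, h2, h3⟩ := hcon
  refine h2 (H.ext _ _ fun a => ⟨fun ha => ?_, fun ha => ?_⟩)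
  · obtain ⟨r, hr, hrs, har⟩ := H.lev_mem hs ha
    rcases ihs r hrs hr t ht with h | rfl | h
    · exact lev_pot ht h har
    · exact (h3 hrs).elim
    · exact (h3 (H.lev_trans hs r hrs t h)).elim
  · obtain ⟨r, hr, hrt, har⟩ := H.lev_mem ht ha
    rcases iht r hrt hr with h | rfl | h
    · exact (h1 (H.lev_trans ht r hrt s h)).elim
    · exact (h1 hrt).elim
    · exact lev_pot hs h har

theorem ZM.lev_of_set (H : ZM e₁ e₂ e) {T : M} (hT : ∀ L, e L T → IsLev e L) :
    ∃ s, IsLev e s ∧ ∀ a, e a s ↔ ∃ L, e L T ∧ ∀ w, e w a → e w L := by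
  have := H.ne
  obtain ⟨s, hs⟩ := H.pot T
  obtain ⟨h, hh⟩ := H.sep (IsLev e) dfn_auto s
  refine ⟨s, ⟨h, ?_, fun a => ?_⟩, hs⟩
  · intro r hr a
    obtain ⟨hrs, hrl⟩ := (hh r).1 hr
    constructor
    · intro ha
      obtain ⟨c, hc, hcr, hac⟩ := H.lev_mem hrl ha
      obtain ⟨L, hL, hrL⟩ := (hs r).1 hrs
      exact ⟨c, hcr, (hh c).2 ⟨(hs c).2 ⟨L, hL, H.lev_trans (hT L hL) c (hrL c hcr)⟩, hc⟩, hac⟩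
    · rintro ⟨c, hcr, _, hac⟩
      exact lev_pot hrl hcr hac
  · rw [hs]
    constructor
    · rintro ⟨L, hL, haL⟩
      exact ⟨L, (hh L).2 ⟨(hs L).2 ⟨L, hL, fun _ h => h⟩, hT L hL⟩, haL⟩
    · rintro ⟨c, hc, hac⟩
      obtain ⟨L, hL, hcL⟩ := (hs c).1 ((hh c).1 hc).1
      exact ⟨L, hL, fun w hw => hcL w (hac w hw)⟩

theorem ZM.ll_uniq (H : ZM e₁ e₂ e) {t L L' : M} (h : IsLL e t L) (h' : IsLL e t L') :
    L = L' := by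
  rcases H.lev_cmp L h.1 L' h'.1 with h1 | h1 | h1
  · exact (h'.2.2 L h.1 h1 h.2.1).elim
  · exact h1
  · exact (h.2.2 L' h'.1 h1 h'.2.1).elim

theorem ZM.ll_of_lev (H : ZM e₁ e₂ e) {t L : M} (hL : IsLev e L) (ht : ∀ w, e w t → e w L) :
    ∃ L', IsLL e t L' := by
  have := H.ne
  obtain ⟨m, hm, hmin⟩ := H.class_min (fun L => IsLev e L ∧ ∀ w, e w t → e w L) ⟨dfn_auto⟩
    (x := L) ⟨hL, ht⟩
  exact ⟨m, hm.1, hm.2, fun L' h1 h2 h3 => hmin L' h2 ⟨h1, h3⟩⟩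

theorem ZM.ll_ex (H : ZM e₁ e₂ e) : ∀ x, ∃ L, IsLL e x L := by
  have := H.ne
  refine H.ind (fun x => ∃ L, IsLL e x L) ⟨dfn_auto⟩ ?_
  intro x ih
  obtain ⟨T, hT⟩ := H.img (IsLL e) inferInstance x (fun _ _ _ _ h h' => H.ll_uniq h h')
  obtain ⟨s, hs, hsT⟩ := H.lev_of_set (T := T) (fun L hL => by
    obtain ⟨t, _, ht⟩ := (hT L).1 hL
    exact ht.1)
  refine H.ll_of_lev hs fun t ht => ?_
  obtain ⟨L, hL⟩ := ih t ht
  exact (hsT t).2 ⟨L, (hT L).2 ⟨t, ht, hL⟩, hL.2.1⟩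

end Basic

/-! ## Bisimulations -/

section Bisim
variable {M : Type u} {e₁ e₂ e e' : M → M → Prop}

/-- The back-and-forth condition. -/
def BF (e e' B : M → M → Prop) (x y : M) : Prop :=
  (∀ t, e t x → ∃ s, e' s y ∧ B t s) ∧ (∀ s, e' s y → ∃ t, e t x ∧ B t s)

/-- Bisimulations between two membership relations. -/
def Bis (e e' B : M → M → Prop) : Prop := ∀ x y, B x y → BF e e' B x y

instance [Nonempty M] {B : M → M → Prop} [DR2 e₁ e₂ e] [DR2 e₁ e₂ e'] [DR2 e₁ e₂ B] :
    DR2 e₁ e₂ (BF e e' B) := ⟨by unfold BF; exact dfn_auto⟩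

/-- Converse relation. -/
def Conv (B : M → M → Prop) (y x : M) : Prop := B x y

instance {B : M → M → Prop} [DR2 e₁ e₂ B] : DR2 e₁ e₂ (Conv B) := ⟨by unfold Conv; exact dfn_auto⟩

theorem Bis.conv {B : M → M → Prop} (h : Bis e e' B) : Bis e' e (Conv B) :=
  fun x y hxy => ⟨(h y x hxy).2, (h y x hxy).1⟩

theorem Bis.bf {B : M → M → Prop} (h : Bis e e' B) : Bis e e' (BF e e' B) := by
  rintro x y ⟨h1, h2⟩
  refine ⟨fun t ht => ?_, fun s hs => ?_⟩
  · obtain ⟨s, hs, hts⟩ := h1 t ht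
    exact ⟨s, hs, h t s hts⟩
  · obtain ⟨t, ht, hts⟩ := h2 s hs
    exact ⟨t, ht, h t s hts⟩

theorem Bis.func (H : ZM e₁ e₂ e) (H' : ZM e₁ e₂ e') {B : M → M → Prop} (hB : DR2 e₁ e₂ B)
    (h : Bis e e' B) : ∀ x y y', B x y → B x y' → y = y' := by
  have := H.ne
  have key : ∀ x, (∀ t, e t x → ∀ y y', B t y → B t y' → y = y') → ∀ y y', B x y → B x y' →
      ∀ s, e' s y → e' s y' := by
    intro x ih y y' hy hy' s hs
    obtain ⟨t, ht, hts⟩ := (h x y hy).2 s hs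
    obtain ⟨s', hs', hts'⟩ := (h x y' hy').1 t ht
    rwa [ih t ht s s' hts hts']
  refine H.ind (fun x => ∀ y y', B x y → B x y' → y = y') ⟨dfn_auto⟩ ?_
  intro x ih y y' hy hy'
  exact H'.ext _ _ fun s => ⟨key x ih y y' hy hy' s, key x ih y' y hy' hy s⟩

theorem Bis.inj (H : ZM e₁ e₂ e) (H' : ZM e₁ e₂ e') {B : M → M → Prop} (hB : DR2 e₁ e₂ B)
    (h : Bis e e' B) : ∀ x x' y, B x y → B x' y → x = x' :=
  fun x x' y hx hx' => h.conv.func H' H inferInstance y x x' hx hx'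

theorem Bis.mem (H : ZM e₁ e₂ e) (H' : ZM e₁ e₂ e') {B : M → M → Prop} (hB : DR2 e₁ e₂ B)
    (h : Bis e e' B) {x y x' y' : M} (h1 : B x y) (h2 : B x' y') : e x x' ↔ e' y y' := by
  constructor
  · intro hx
    obtain ⟨s, hs, hxs⟩ := (h x' y' h2).1 x hx
    rwa [h.func H H' hB x y s h1 hxs]
  · intro hy
    obtain ⟨t, ht, hty⟩ := (h x' y' h2).2 y hy
    rwa [h.inj H H' hB x t y h1 hty]

/-! ### `φ` is the greatest definable bisimulation -/

theorem phi_sub (H₁ : ZM e₁ e₂ e₁) (H₂ : ZM e₁ e₂ e₂) {x y f sx tcsx tcx tcy : M}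
    (hsx : IsSingleton e₁ x sx) (htcsx : IsTC e₁ sx tcsx) (htcx : IsTC e₁ x tcx)
    (htcy : IsTC e₂ y tcy) (hf : IsFuncOn e₁ f tcsx)
    (h2 : ∀ t, e₁ t tcx → ∀ ft, FunVal e₁ f t ft → e₂ ft tcy)
    (h3 : ∀ t, e₂ t tcy → ∃ w, e₁ w tcx ∧ FunVal e₁ f w t)
    (h4 : ∀ t, e₁ t tcx → ∀ w, e₁ w tcsx → ∀ ft fw,
      FunVal e₁ f t ft → FunVal e₁ f w fw → (e₁ t w ↔ e₂ ft fw))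
    {t s : M} (ht : e₁ t tcx) (hts : FunVal e₁ f t s) : Phi e₁ e₂ t s := by
  have := H₁.ne
  have hsub : ∀ a, e₁ a tcx → e₁ a tcsx := fun a ha => (H₁.tc_sing hsx htcx htcsx a).2 (Or.inl ha)
  obtain ⟨st, hst⟩ := H₁.exSing t
  obtain ⟨tcst, htcst⟩ := H₁.exTC st
  obtain ⟨tct, htct⟩ := H₁.exTC t
  obtain ⟨tcs, htcs⟩ := H₂.exTC s
  have hsing := H₁.tc_sing hst htct htcst
  have htx : ∀ a, e₁ a tct → e₁ a tcx :=
    htct.2.2 tcx htcx.1 (fun w hw => htcx.1 t ht w hw)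
  have htx' : ∀ a, e₁ a tcst → e₁ a tcx := by
    intro a ha
    rcases (hsing a).1 ha with h | rfl
    · exact htx a h
    · exact ht
  obtain ⟨g, hg⟩ := H₁.sep (fun p => ∃ a b, IsOPair e₁ a b p ∧ e₁ a tcst) dfn_auto f
  have hgf : ∀ a b, FunVal e₁ g a b ↔ FunVal e₁ f a b ∧ e₁ a tcst := by
    intro a b
    constructor
    · rintro ⟨p, hp, hab⟩
      obtain ⟨hpf, a', b', hab', ha'⟩ := (hg p).1 hp
      obtain ⟨rfl, rfl⟩ := opair_inj hab hab'
      exact ⟨⟨p, hpf, hab⟩, ha'⟩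
    · rintro ⟨⟨p, hp, hab⟩, ha⟩
      exact ⟨p, (hg p).2 ⟨hp, a, b, hab, ha⟩, hab⟩
  have hsy : e₂ s tcy := h2 t ht s hts
  have hval : ∀ a, e₁ a tcx → ∃ b, FunVal e₁ f a b := fun a ha => hf.2.1 a (hsub a ha)
  refine ⟨g, st, tcst, tct, tcs, hst, htcst, htct, htcs, ⟨?_, ?_, ?_⟩, ?_, ?_, ?_, ?_⟩
  · intro p hp
    obtain ⟨_, a, b, hab, ha⟩ := (hg p).1 hp
    exact ⟨a, b, ha, hab⟩
  · intro a ha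
    obtain ⟨b, hb⟩ := hval a (htx' a ha)
    exact ⟨b, (hgf a b).2 ⟨hb, ha⟩⟩
  · intro a b b' hb hb'
    exact hf.2.2 a b b' ((hgf _ _).1 hb).1 ((hgf _ _).1 hb').1
  · have key : ∀ u, e₁ u tct → ∀ fu, FunVal e₁ f u fu → e₂ fu tcs := by
      refine H₁.tc_ind htct (fun u => ∀ fu, FunVal e₁ f u fu → e₂ fu tcs) ⟨dfn_auto⟩ ?_ ?_
      · intro u hu fu hfu
        exact htcs.2.1 fu ((h4 u (htx u (htct.2.1 u hu)) t (hsub t ht) fu s hfu hts).1 hu)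
      · intro u hu ih w hw fw hfw
        obtain ⟨fu, hfu⟩ := hval u (htx u hu)
        refine htcs.1 fu (ih fu hfu) fw ?_
        exact (h4 w (htx w (htct.1 u hu w hw)) u (hsub u (htx u hu)) fw fu hfw hfu).1 hw
    exact fun u hu fu hfu => key u hu fu ((hgf _ _).1 hfu).1
  · have key : ∀ v, e₂ v tcs → ∃ u, e₁ u tct ∧ FunVal e₁ f u v := by
      have hsub2 : ∀ a, e₂ a tcs → e₂ a tcy :=
        htcs.2.2 tcy htcy.1 (fun w hw => htcy.1 s hsy w hw)
      refine H₂.tc_ind htcs (fun v => ∃ u, e₁ u tct ∧ FunVal e₁ f u v) ⟨dfn_auto⟩ ?_ ?_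
      · intro v hv
        obtain ⟨w, hw, hwv⟩ := h3 v (htcy.1 s hsy v hv)
        exact ⟨w, htct.2.1 w ((h4 w hw t (hsub t ht) v s hwv hts).2 hv), hwv⟩
      · rintro v hv ⟨u, hu, huv⟩ v' hv'
        obtain ⟨w, hw, hwv⟩ := h3 v' (htcy.1 v (hsub2 v hv) v' hv')
        exact ⟨w, htct.1 u hu w ((h4 w hw u (hsub u (htx u hu)) v' v hwv huv).2 hv'), hwv⟩
    intro v hv
    obtain ⟨u, hu, huv⟩ := key v hv
    exact ⟨u, hu, (hgf _ _).2 ⟨huv, (hsing u).2 (Or.inl hu)⟩⟩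
  · intro a ha b hb fa fb hfa hfb
    exact h4 a (htx a ha) b (hsub b (htx' b hb)) fa fb ((hgf _ _).1 hfa).1 ((hgf _ _).1 hfb).1
  · exact (hgf _ _).2 ⟨hts, (hsing t).2 (Or.inr rfl)⟩

theorem phi_bis (H₁ : ZM e₁ e₂ e₁) (H₂ : ZM e₁ e₂ e₂) : Bis e₁ e₂ (Phi e₁ e₂) := by
  rintro x y ⟨f, sx, tcsx, tcx, tcy, hsx, htcsx, htcx, htcy, hf, h2, h3, h4, h5⟩
  have hsing := H₁.tc_sing hsx htcx htcsx
  have hx : e₁ x tcsx := (hsing x).2 (Or.inr rfl)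
  refine ⟨fun t ht => ?_, fun s hs => ?_⟩
  · have htx := htcx.2.1 t ht
    obtain ⟨s, hs⟩ := hf.2.1 t ((hsing t).2 (Or.inl htx))
    exact ⟨s, (h4 t htx x hx s y hs h5).1 ht,
      phi_sub H₁ H₂ hsx htcsx htcx htcy hf h2 h3 h4 htx hs⟩
  · obtain ⟨w, hw, hws⟩ := h3 s (htcy.2.1 s hs)
    exact ⟨w, (h4 w hw x hx s y hws h5).2 hs,
      phi_sub H₁ H₂ hsx htcsx htcx htcy hf h2 h3 h4 hw hws⟩

theorem phi_of_bis (H₁ : ZM e₁ e₂ e₁) (H₂ : ZM e₁ e₂ e₂) {B : M → M → Prop}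
    (hB : DR2 e₁ e₂ B) (h : Bis e₁ e₂ B) {x y : M} (hxy : B x y) : Phi e₁ e₂ x y := by
  have := H₁.ne
  obtain ⟨sx, hsx⟩ := H₁.exSing x
  obtain ⟨tcsx, htcsx⟩ := H₁.exTC sx
  obtain ⟨tcx, htcx⟩ := H₁.exTC x
  obtain ⟨tcy, htcy⟩ := H₂.exTC y
  have hsing := H₁.tc_sing hsx htcx htcsx
  have fn := h.func H₁ H₂ hB
  have hm : ∀ {a b a' b'}, B a b → B a' b' → (e₁ a a' ↔ e₂ b b') := h.mem H₁ H₂ hB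
  have k1 : ∀ t, e₁ t tcx → ∃ s, e₂ s tcy ∧ B t s := by
    refine H₁.tc_ind htcx (fun t => ∃ s, e₂ s tcy ∧ B t s) ⟨dfn_auto⟩ ?_ ?_
    · intro t ht
      obtain ⟨s, hs, hts⟩ := (h x y hxy).1 t ht
      exact ⟨s, htcy.2.1 s hs, hts⟩
    · rintro t _ ⟨s, hs, hts⟩ w hw
      obtain ⟨s', hs', hws⟩ := (h t s hts).1 w hw
      exact ⟨s', htcy.1 s hs s' hs', hws⟩
  have k2 : ∀ s, e₂ s tcy → ∃ t, e₁ t tcx ∧ B t s := by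
    refine H₂.tc_ind htcy (fun s => ∃ t, e₁ t tcx ∧ B t s) ⟨dfn_auto⟩ ?_ ?_
    · intro s hs
      obtain ⟨t, ht, hts⟩ := (h x y hxy).2 s hs
      exact ⟨t, htcx.2.1 t ht, hts⟩
    · rintro s _ ⟨t, ht, hts⟩ w hw
      obtain ⟨t', ht', hws⟩ := (h t s hts).2 w hw
      exact ⟨t', htcx.1 t ht t' ht', hws⟩
  obtain ⟨f, hf⟩ := H₁.img (fun t p => ∃ s, B t s ∧ IsOPair e₁ t s p) ⟨dfn_auto⟩ tcsx (by
    rintro t _ p p' ⟨s, hs, hp⟩ ⟨s', hs', hp'⟩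
    obtain rfl := fn t s s' hs hs'
    exact H₁.opair_uniq hp hp')
  have hv : ∀ a b, FunVal e₁ f a b ↔ e₁ a tcsx ∧ B a b := by
    intro a b
    constructor
    · rintro ⟨p, hp, hab⟩
      obtain ⟨a', ha', b', hb', hab'⟩ := (hf p).1 hp
      obtain ⟨rfl, rfl⟩ := opair_inj hab hab'
      exact ⟨ha', hb'⟩
    · rintro ⟨ha, hab⟩
      obtain ⟨p, hp⟩ := H₁.opair a b
      exact ⟨p, (hf p).2 ⟨a, ha, b, hab, hp⟩, hp⟩
  refine ⟨f, sx, tcsx, tcx, tcy, hsx, htcsx, htcx, htcy, ⟨?_, ?_, ?_⟩, ?_, ?_, ?_, ?_⟩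
  · intro p hp
    obtain ⟨a, ha, b, _, hab⟩ := (hf p).1 hp
    exact ⟨a, b, ha, hab⟩
  · intro a ha
    rcases (hsing a).1 ha with h' | rfl
    · obtain ⟨b, _, hb⟩ := k1 a h'
      exact ⟨b, (hv a b).2 ⟨ha, hb⟩⟩
    · exact ⟨y, (hv _ _).2 ⟨ha, hxy⟩⟩
  · intro a b b' hb hb'
    exact fn a b b' ((hv _ _).1 hb).2 ((hv _ _).1 hb').2
  · intro t ht s hs
    obtain ⟨s', hs', hts'⟩ := k1 t ht
    rwa [fn t s s' ((hv _ _).1 hs).2 hts']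
  · intro s hs
    obtain ⟨t, ht, hts⟩ := k2 s hs
    exact ⟨t, ht, (hv _ _).2 ⟨(hsing t).2 (Or.inl ht), hts⟩⟩
  · intro t _ w _ ft fw hft hfw
    exact hm ((hv _ _).1 hft).2 ((hv _ _).1 hfw).2
  · exact (hv _ _).2 ⟨(hsing x).2 (Or.inr rfl), hxy⟩

/-! ### The domain of a maximal bisimulation is everything or a set -/

theorem dom_of_bdd (H : ZM e₁ e₂ e) (H' : ZM e₁ e₂ e') {B : M → M → Prop} (hB : DR2 e₁ e₂ B)
    (h : Bis e e' B) (hmax : ∀ x y, BF e e' B x y → B x y) {x y' : M}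
    (hx : ∀ t, e t x → ∃ s, B t s ∧ e' s y') : ∃ y, B x y := by
  have := H.ne
  obtain ⟨y, hy⟩ := H'.sep (fun s => ∃ t, e t x ∧ B t s) dfn_auto y'
  refine ⟨y, hmax x y ⟨fun t ht => ?_, fun s hs => ((hy s).1 hs).2⟩⟩
  obtain ⟨s, hs, hsy⟩ := hx t ht
  exact ⟨s, (hy s).2 ⟨hsy, t, ht, hs⟩, hs⟩

theorem dom_sub (H : ZM e₁ e₂ e) (H' : ZM e₁ e₂ e') {B : M → M → Prop} (hB : DR2 e₁ e₂ B)
    (h : Bis e e' B) (hmax : ∀ x y, BF e e' B x y → B x y) {x z y : M}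
    (hz : B z y) (hx : ∀ t, e t x → e t z) : ∃ y, B x y := by
  refine dom_of_bdd H H' hB h hmax (y' := y) fun t ht => ?_
  obtain ⟨s, hs, hts⟩ := (h z y hz).1 t (hx t ht)
  exact ⟨s, hts, hs⟩

theorem dom_trans {B : M → M → Prop} (h : Bis e e' B) {x z : M} (hz : ∃ y, B z y)
    (hx : e x z) : ∃ y, B x y := by
  obtain ⟨y, hy⟩ := hz
  obtain ⟨s, _, hs⟩ := (h z y hy).1 x hx
  exact ⟨s, hs⟩

theorem dom_lev (H : ZM e₁ e₂ e) (H' : ZM e₁ e₂ e') {B : M → M → Prop} (hB : DR2 e₁ e₂ B)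
    (h : Bis e e' B) (hmax : ∀ x y, BF e e' B x y → B x y) :
    ∀ z, (∃ y, B z y) → ∃ L, IsLL e z L ∧ ∃ y, B L y := by
  have := H.ne
  refine H.ind (fun z => (∃ y, B z y) → ∃ L, IsLL e z L ∧ ∃ y, B L y) ⟨dfn_auto⟩ ?_
  rintro z ih ⟨y, hzy⟩
  have fn := h.func H H' hB
  obtain ⟨T, hT⟩ := H.img (IsLL e) inferInstance z (fun _ _ _ _ h h' => H.ll_uniq h h')
  obtain ⟨y', hy'⟩ := H'.img (fun s s' => ∃ t L, B t s ∧ IsLL e t L ∧ B L s') ⟨dfn_auto⟩ y (by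
    rintro s _ s₁ s₂ ⟨t, L, h1, h2, h3⟩ ⟨t', L', h1', h2', h3'⟩
    obtain rfl := h.inj H H' hB t t' s h1 h1'
    obtain rfl := H.ll_uniq h2 h2'
    exact fn L s₁ s₂ h3 h3')
  obtain ⟨yT, hyT⟩ : ∃ yT, B T yT := by
    refine dom_of_bdd H H' hB h hmax (y' := y') fun L hL => ?_
    obtain ⟨t, ht, htL⟩ := (hT L).1 hL
    obtain ⟨s, hs, hts⟩ := (h z y hzy).1 t ht
    obtain ⟨L', hL', s', hs'⟩ := ih t ht ⟨s, hts⟩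
    obtain rfl := H.ll_uniq htL hL'
    exact ⟨s', hs', (hy' s').2 ⟨s, hs, t, L, hts, htL, hs'⟩⟩
  obtain ⟨S, hS, hST⟩ := H.lev_of_set (T := T) (fun L hL => by
    obtain ⟨t, _, ht⟩ := (hT L).1 hL
    exact ht.1)
  have hSD : ∃ y, B S y := by
    obtain ⟨q, hq⟩ := H'.pot yT
    refine dom_of_bdd H H' hB h hmax (y' := q) fun a ha => ?_
    obtain ⟨L, hL, haL⟩ := (hST a).1 ha
    obtain ⟨s, hs, hLs⟩ := (h T yT hyT).1 L hL
    obtain ⟨b, hb⟩ := dom_sub H H' hB h hmax hLs haL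
    refine ⟨b, hb, (hq b).2 ⟨s, hs, fun w hw => ?_⟩⟩
    obtain ⟨t, ht, htw⟩ := (h a b hb).2 w hw
    exact (h.mem H H' hB htw hLs).1 (haL t ht)
  have hzS : ∀ w, e w z → e w S := by
    intro t ht
    obtain ⟨L, hL⟩ := H.ll_ex t
    exact (hST t).2 ⟨L, (hT L).2 ⟨t, ht, hL⟩, hL.2.1⟩
  obtain ⟨L, hL⟩ := H.ll_of_lev hS hzS
  refine ⟨L, hL, ?_⟩
  rcases H.lev_cmp L hL.1 S hS with h1 | rfl | h1
  · exact dom_trans h hSD h1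
  · exact hSD
  · exact (hL.2.2 S hS h1 hzS).elim

theorem dom_small (H : ZM e₁ e₂ e) (H' : ZM e₁ e₂ e') {B : M → M → Prop} (hB : DR2 e₁ e₂ B)
    (h : Bis e e' B) (hmax : ∀ x y, BF e e' B x y → B x y) :
    (∀ x, ∃ y, B x y) ∨ ∃ d, ∀ x, e x d ↔ ∃ y, B x y := by
  have := H.ne
  by_cases hall : ∀ x, ∃ y, B x y
  · exact Or.inl hall
  right
  obtain ⟨x, hx⟩ := not_forall.1 hall
  obtain ⟨L, hL⟩ := H.ll_ex x
  have hLD : ¬ ∃ y, B L y := fun ⟨y, hy⟩ => hx (dom_sub H H' hB h hmax hy hL.2.1)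
  obtain ⟨d, hd⟩ := H.sep (fun z => ∃ y, B z y) dfn_auto L
  refine ⟨d, fun z => ?_⟩
  rw [hd, and_iff_right_of_imp]
  intro hz
  obtain ⟨K, hK, hKD⟩ := dom_lev H H' hB h hmax z hz
  rcases H.lev_cmp K hK.1 L hL.1 with h1 | rfl | h1
  · exact lev_pot hL.1 h1 hK.2.1
  · exact (hLD hKD).elim
  · exact (hLD (dom_trans h hKD h1)).elim

theorem not_all (H : ZM e₁ e₂ e) (H' : ZM e₁ e₂ e') {B : M → M → Prop} (hB : DR2 e₁ e₂ B)
    (h : Bis e e' B) (hall : ∀ y, ∃ x, B x y) {d : M} (hd : ∀ x, e x d ↔ ∃ y, B x y) : False := by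
  obtain ⟨b, hb⟩ := H.img B hB d (fun t _ s s' => h.func H H' hB t s s')
  refine H.irrefl (a := b) ((hb b).2 ?_)
  obtain ⟨x, hx⟩ := hall b
  exact ⟨x, (hd x).2 ⟨b, hx⟩, hx⟩

theorem bis_total (H : ZM e₁ e₂ e) (H' : ZM e₁ e₂ e') {B : M → M → Prop} (hB : DR2 e₁ e₂ B)
    (h : Bis e e' B) (hmax : ∀ x y, BF e e' B x y → B x y) :
    (∀ x, ∃ y, B x y) ∧ (∀ y, ∃ x, B x y) := by
  have hmax' : ∀ x y, BF e' e (Conv B) x y → Conv B x y := fun x y hxy => hmax y x ⟨hxy.2, hxy.1⟩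
  have hC : DR2 e₁ e₂ (Conv B) := inferInstance
  rcases dom_small H H' hB h hmax with h1 | ⟨d, hd⟩
  · rcases dom_small H' H hC h.conv hmax' with h2 | ⟨r, hr⟩
    · exact ⟨h1, h2⟩
    · exact (not_all H' H hC h.conv h1 hr).elim
  · rcases dom_small H' H hC h.conv hmax' with h2 | ⟨r, hr⟩
    · exact (not_all H H' hB h h2 hd).elim
    · exfalso
      refine H.irrefl (a := d) ((hd d).2 ⟨r, hmax d r ⟨fun t ht => ?_, fun s hs => ?_⟩⟩)
      · obtain ⟨s, hs⟩ := (hd t).1 ht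
        exact ⟨s, (hr s).2 ⟨t, hs⟩, hs⟩
      · obtain ⟨t, ht⟩ := (hr s).1 hs
        exact ⟨t, (hd t).2 ⟨s, ht⟩, ht⟩

end Bisim

/-- In a model of `ZFC(∈₁) ∪ ZFC(∈₂)`, the binary relation defined by
`φ(x, y)` is the graph of a bijection `F : M → M` satisfying
`x ∈₁ x' ↔ F(x) ∈₂ F(x')`; i.e. `φ` defines an isomorphism between the
reduct `(M, ∈₁)` and the reduct `(M, ∈₂)`. -/
theorem phi_defines_isomorphism {M : Type u} (Z : ZFC2Model M) :
    ∃ F : M ≃ M, (∀ x y : M, Phi Z.mem1 Z.mem2 x y ↔ F x = y) ∧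
      (∀ x x' : M, Z.mem1 x x' ↔ Z.mem2 (F x) (F x')) := by
  have H₁ := Z.zm1
  have H₂ := Z.zm2
  have := H₁.ne
  have hB : DR2 Z.mem1 Z.mem2 (Phi Z.mem1 Z.mem2) := inferInstance
  have h := phi_bis H₁ H₂
  obtain ⟨h1, h2⟩ := bis_total H₁ H₂ hB h
    (fun x y hxy => phi_of_bis H₁ H₂ inferInstance h.bf hxy)
  choose F hF using h1
  choose G hG using h2
  refine ⟨⟨F, G, fun x => h.inj H₁ H₂ hB _ _ _ (hG (F x)) (hF x),
    fun y => h.func H₁ H₂ hB _ _ _ (hF (G y)) (hG y)⟩, fun x y => ⟨fun hxy => ?_, ?_⟩,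
    fun x x' => h.mem H₁ H₂ hB (hF x) (hF x')⟩
  · exact h.func H₁ H₂ hB _ _ _ (hF x) hxy
  · rintro rfl
    exact hF x
end

section
/- (Zermelo's theorem, as a consequence of the main theorem.) Let M be a set and let ∈₁ and ∈₂ be binary relations on M such that both (M, ∈₁) and (M, ∈₂) satisfy the second-order Zermelo–Fraenkel axioms, i.e. each (M, ∈ᵢ) satisfies the first-order ZFC axioms other than Separation and Replacement, and in addition satisfies full second-order Separation (for every subset A ⊆ M and every a ∈ M there is b ∈ M whose ∈ᵢ-elements are exactly the ∈ᵢ-elements of a that belong to A) and full second-order Replacement (for every function G : M → M and every a ∈ M there is b ∈ M whose ∈ᵢ-elements include G(t) for every t ∈ᵢ a). Then (M, ∈₁) and (M, ∈₂) are isomorphic. -/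
universe u

/-- A model `(M, ∈)` of second-order ZFC: the first-order ZFC axioms other
than Separation and Replacement hold, together with full (semantic)
second-order Separation and Replacement, where the subsets `A` range over
all subsets of `M` and the functions `G` over all functions `M → M`. -/
structure ZFC2ndOrderModel (M : Type u) : Type u where
  mem : M → M → Prop
  ext : Extensionality mem
  found : Foundation mem
  pair : Pairing mem
  union : UnionAx mem
  power : PowerSetAx mem
  infinity : InfinityAx mem
  choice : ChoiceAx mem
  /-- Full second-order Separation: for every subset `A ⊆ M` and every
  `a ∈ M` there is `b ∈ M` whose `∈`-elements are exactly the `∈`-elements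
  of `a` that belong to `A`. -/
  sep2nd : ∀ (A : Set M) (a : M), ∃ b : M, ∀ t, mem t b ↔ (mem t a ∧ t ∈ A)
  /-- Full second-order Replacement: for every function `G : M → M` and
  every `a ∈ M` there is `b ∈ M` whose `∈`-elements include `G(t)` for
  every `t ∈ a`. -/
  repl2nd : ∀ (G : M → M) (a : M), ∃ b : M, ∀ t, mem t a → mem (G t) b

namespace ZermeloAux

variable {M : Type u}

theorem not_self (Z : ZFC2ndOrderModel M) (x : M) : ¬ Z.mem x x := by
  intro h
  obtain ⟨p, hp⟩ := Z.pair x x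
  obtain ⟨t, ht, hs⟩ := Z.found p ⟨x, (hp x).2 (Or.inl rfl)⟩
  have htx : t = x := by simpa using (hp t).1 ht
  subst htx
  exact hs t h ht

/-- An injective sequence inside a set. -/
theorem exists_seq (Z : ZFC2ndOrderModel M) :
    ∃ (w : M) (z : ℕ → M), Function.Injective z ∧ ∀ n, Z.mem (z n) w := by
  obtain ⟨w, ⟨z0, hz0, -⟩, hw⟩ := Z.infinity
  have hw' : ∀ t : {t // Z.mem t w}, ∃ s : {t // Z.mem t w},
      ∀ u, Z.mem u s.1 ↔ (Z.mem u t.1 ∨ u = t.1) := by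
    rintro ⟨t, ht⟩
    obtain ⟨s, hs, h⟩ := hw t ht
    exact ⟨⟨s, hs⟩, h⟩
  choose S hS using hw'
  let z : ℕ → {t // Z.mem t w} := fun n => Nat.rec ⟨z0, hz0⟩ (fun _ t => S t) n
  have hz : ∀ n, z (n + 1) = S (z n) := fun _ => rfl
  have hlt : ∀ n m, m < n → Z.mem (z m).1 (z n).1 := by
    intro n
    induction n with
    | zero => intro m hm; omega
    | succ n ih =>
      intro m hm
      rw [hz, hS]
      rcases Nat.lt_succ_iff_lt_or_eq.1 hm with h | h
      · exact Or.inl (ih m h)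
      · right; rw [h]
  refine ⟨w, fun n => (z n).1, ?_, fun n => (z n).2⟩
  intro m n hmn
  have hmn' : (z m).1 = (z n).1 := hmn
  rcases lt_trichotomy m n with h | h | h
  · have := hlt n m h
    rw [hmn'] at this
    exact (not_self Z _ this).elim
  · exact h
  · have := hlt m n h
    rw [hmn'] at this
    exact (not_self Z _ this).elim

theorem wf (Z : ZFC2ndOrderModel M) : WellFounded Z.mem := by
  rw [wellFounded_iff_isEmpty_descending_chain]
  refine ⟨?_⟩
  rintro ⟨f, hf⟩
  obtain ⟨w, z, hz, hzw⟩ := exists_seq Z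
  haveI : Nonempty M := ⟨w⟩
  obtain ⟨b, hb⟩ := Z.repl2nd (fun t => f (Function.invFun z t)) w
  obtain ⟨c, hc⟩ := Z.sep2nd (Set.range f) b
  have hfc : ∀ n, Z.mem (f n) c := by
    intro n
    refine (hc _).2 ⟨?_, ⟨n, rfl⟩⟩
    have := hb (z n) (hzw n)
    simpa [Function.leftInverse_invFun hz n] using this
  obtain ⟨t, ht, hs⟩ := Z.found c ⟨_, hfc 0⟩
  obtain ⟨n, rfl⟩ := ((hc t).1 ht).2
  exact hs _ (hf n) (hfc (n + 1))

/-- The ordinal rank of an element. -/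
noncomputable def rk (Z : ZFC2ndOrderModel M) (x : M) : Ordinal.{u} :=
  haveI : IsWellFounded M Z.mem := ⟨wf Z⟩
  IsWellFounded.rank Z.mem x

theorem rk_lt (Z : ZFC2ndOrderModel M) {x y : M} (h : Z.mem x y) : rk Z x < rk Z y := by
  haveI : IsWellFounded M Z.mem := ⟨wf Z⟩
  exact IsWellFounded.rank_lt_of_rel h

theorem rk_le_iff (Z : ZFC2ndOrderModel M) (x : M) (o : Ordinal.{u}) :
    rk Z x ≤ o ↔ ∀ t, Z.mem t x → rk Z t < o := by
  haveI : IsWellFounded M Z.mem := ⟨wf Z⟩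
  constructor
  · intro h t ht
    exact (rk_lt Z ht).trans_le h
  · intro h
    unfold rk
    rw [IsWellFounded.rank_eq]
    refine Ordinal.iSup_le ?_
    rintro ⟨t, ht⟩
    exact Order.succ_le_of_lt (h t ht)

theorem lt_rk_iff (Z : ZFC2ndOrderModel M) (x : M) (o : Ordinal.{u}) :
    o < rk Z x ↔ ∃ t, Z.mem t x ∧ o ≤ rk Z t := by
  rw [← not_le, rk_le_iff]
  push Not
  rfl

/-- Levels of the cumulative hierarchy. -/
theorem exists_level (Z : ZFC2ndOrderModel M) (a : M) :
    ∃ v, ∀ t, Z.mem t v ↔ rk Z t ≤ rk Z a := by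
  induction a using (wf Z).induction with
  | _ a ih =>
    classical
    have h' : ∀ s, ∃ v, Z.mem s a → ∀ t, Z.mem t v ↔ rk Z t ≤ rk Z s := by
      intro s
      by_cases hs : Z.mem s a
      · obtain ⟨v, hv⟩ := ih s hs
        exact ⟨v, fun _ => hv⟩
      · exact ⟨a, fun h => absurd h hs⟩
    choose G hG using h'
    obtain ⟨b, hb⟩ := Z.repl2nd G a
    obtain ⟨c, hc⟩ := Z.union b
    obtain ⟨d, hd⟩ := Z.sep2nd {t | rk Z t < rk Z a} c
    obtain ⟨p, hp⟩ := Z.power d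
    refine ⟨p, fun t => ?_⟩
    rw [hp, rk_le_iff]
    refine forall_congr' fun u => imp_congr_right fun _ => ?_
    rw [hd]
    constructor
    · exact fun h => h.2
    · intro h
      refine ⟨?_, h⟩
      obtain ⟨s, hs, hus⟩ := (lt_rk_iff Z a _).1 h
      exact (hc u).2 ⟨G s, hb s hs, (hG s hs u).2 hus⟩

/-- Bisimulation fixed points. -/
def IsB (Z₁ Z₂ : ZFC2ndOrderModel M) (R : M → M → Prop) : Prop :=
  ∀ x y, R x y ↔ (∀ t, Z₁.mem t x → ∃ s, Z₂.mem s y ∧ R t s) ∧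
    (∀ s, Z₂.mem s y → ∃ t, Z₁.mem t x ∧ R t s)

theorem IsB.swap {Z₁ Z₂ : ZFC2ndOrderModel M} {R : M → M → Prop} (h : IsB Z₁ Z₂ R) :
    IsB Z₂ Z₁ (fun y x => R x y) := by
  intro y x
  exact (h x y).trans and_comm

theorem exists_isB (Z₁ Z₂ : ZFC2ndOrderModel M) : ∃ R, IsB Z₁ Z₂ R := by
  let step : (M → M → Prop) → M → M → Prop := fun S x y =>
    (∀ t, Z₁.mem t x → ∃ s, Z₂.mem s y ∧ S t s) ∧
    (∀ s, Z₂.mem s y → ∃ t, Z₁.mem t x ∧ S t s)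
  have mono : ∀ S T : M → M → Prop, (∀ x y, S x y → T x y) →
      ∀ x y, step S x y → step T x y := by
    intro S T h x y hs
    refine ⟨fun t ht => ?_, fun s hs' => ?_⟩
    · obtain ⟨s, h1, h2⟩ := hs.1 t ht
      exact ⟨s, h1, h _ _ h2⟩
    · obtain ⟨t, h1, h2⟩ := hs.2 s hs'
      exact ⟨t, h1, h _ _ h2⟩
  let R : M → M → Prop := fun x y => ∃ S, (∀ x y, S x y → step S x y) ∧ S x y
  have h1 : ∀ x y, R x y → step R x y := by
    rintro x y ⟨S, hS, hxy⟩
    exact mono S R (fun a b hab => ⟨S, hS, hab⟩) x y (hS x y hxy)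
  refine ⟨R, fun x y => ⟨h1 x y, fun h => ?_⟩⟩
  exact ⟨step R, fun a b hab => mono R (step R) h1 a b hab, h⟩

variable {Z₁ Z₂ : ZFC2ndOrderModel M} {R : M → M → Prop}

theorem IsB.uniq (h : IsB Z₁ Z₂ R) : ∀ x y y', R x y → R x y' → y = y' := by
  intro x
  induction x using (wf Z₁).induction with
  | _ x ih =>
    have key : ∀ y y', R x y → R x y' → ∀ s, Z₂.mem s y → Z₂.mem s y' := by
      intro y y' hy hy' s hs
      obtain ⟨t, ht, hts⟩ := ((h x y).1 hy).2 s hs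
      obtain ⟨s', hs', hts'⟩ := ((h x y').1 hy').1 t ht
      rw [ih t ht s s' hts hts']
      exact hs'
    intro y y' hy hy'
    exact Z₂.ext y y' fun s => ⟨key y y' hy hy' s, key y' y hy' hy s⟩

theorem IsB.rk_eq (h : IsB Z₁ Z₂ R) : ∀ x y, R x y → rk Z₁ x = rk Z₂ y := by
  intro x
  induction x using (wf Z₁).induction with
  | _ x ih =>
    intro y hy
    apply le_antisymm
    · rw [rk_le_iff]
      intro t ht
      obtain ⟨s, hs, hts⟩ := ((h x y).1 hy).1 t ht
      rw [ih t ht s hts]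
      exact rk_lt Z₂ hs
    · rw [rk_le_iff]
      intro s hs
      obtain ⟨t, ht, hts⟩ := ((h x y).1 hy).2 s hs
      rw [← ih t ht s hts]
      exact rk_lt Z₁ ht

/-- The domain is closed downwards under rank. -/
theorem IsB.dom_of_rk_le (h : IsB Z₁ Z₂ R) {x y : M} (hxy : R x y) :
    ∀ t, rk Z₁ t ≤ rk Z₁ x → ∃ z, R t z := by
  intro t
  induction t using (wf Z₁).induction with
  | _ t ih =>
    intro ht
    obtain ⟨v, hv⟩ := exists_level Z₂ y
    obtain ⟨z, hz⟩ := Z₂.sep2nd {s | ∃ u, Z₁.mem u t ∧ R u s} v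
    refine ⟨z, (h t z).2 ⟨fun u hu => ?_, fun s hs => ((hz s).1 hs).2⟩⟩
    have hux : rk Z₁ u ≤ rk Z₁ x := (rk_lt Z₁ hu).le.trans ht
    obtain ⟨s, hs⟩ := ih u hu hux
    refine ⟨s, (hz s).2 ⟨(hv s).2 ?_, u, hu, hs⟩, hs⟩
    rw [← h.rk_eq u s hs, ← h.rk_eq x y hxy]
    exact hux

/-- A domain which is not everything is a set. -/
theorem IsB.dom_set (h : IsB Z₁ Z₂ R) {x : M} (hx : ¬ ∃ y, R x y) :
    ∃ X, ∀ t, Z₁.mem t X ↔ ∃ y, R t y := by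
  obtain ⟨v, hv⟩ := exists_level Z₁ x
  obtain ⟨X, hX⟩ := Z₁.sep2nd {t | ∃ y, R t y} v
  refine ⟨X, fun t => ⟨fun ht => ((hX t).1 ht).2, fun ht => (hX t).2 ⟨(hv t).2 ?_, ht⟩⟩⟩
  obtain ⟨y, hy⟩ := ht
  by_contra hlt
  exact hx (h.dom_of_rk_le hy x (not_le.1 hlt).le)

theorem IsB.not_both (h : IsB Z₁ Z₂ R) {x y : M} (hx : ¬ ∃ s, R x s) (hy : ¬ ∃ t, R t y) :
    False := by
  obtain ⟨X, hX⟩ := h.dom_set hx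
  obtain ⟨Y, hY⟩ := h.swap.dom_set hy
  have hXY : R X Y := by
    refine (h X Y).2 ⟨fun t ht => ?_, fun s hs => ?_⟩
    · obtain ⟨s, hs⟩ := (hX t).1 ht
      exact ⟨s, (hY s).2 ⟨t, hs⟩, hs⟩
    · obtain ⟨t, ht⟩ := (hY s).1 hs
      exact ⟨t, (hX t).2 ⟨s, ht⟩, ht⟩
  exact not_self Z₁ X ((hX X).2 ⟨Y, hXY⟩)

theorem IsB.total (h : IsB Z₁ Z₂ R) (x : M) : ∃ y, R x y := by
  by_contra hx
  have hr : ∀ y, ∃ t, R t y := fun y => by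
    by_contra hy
    exact h.not_both hx hy
  obtain ⟨X, hX⟩ := h.dom_set hx
  have hG : ∀ t, ∃ y, (∃ y', R t y') → R t y := by
    intro t
    by_cases ht : ∃ y, R t y
    · obtain ⟨y, hy⟩ := ht
      exact ⟨y, fun _ => hy⟩
    · exact ⟨t, fun h => absurd h ht⟩
  choose G hG using hG
  choose g hg using hr
  -- the map `G` sends the set `X` onto everything
  obtain ⟨b, hb⟩ := Z₁.repl2nd G X
  have hb' : G (g b) = b := h.uniq (g b) _ _ (hG _ ⟨b, hg b⟩) (hg b)
  have := hb (g b) ((hX _).2 ⟨b, hg b⟩)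
  rw [hb'] at this
  exact not_self Z₁ b this

end ZermeloAux

/-- **Zermelo's theorem.** If `∈₁` and `∈₂` are binary relations on `M`
such that both `(M, ∈₁)` and `(M, ∈₂)` satisfy the second-order
Zermelo–Fraenkel axioms, then `(M, ∈₁) ≅ (M, ∈₂)`. -/
theorem zermelo_second_order_categoricity {M : Type u}
    (Z₁ Z₂ : ZFC2ndOrderModel M) : Nonempty (Z₁.mem ≃r Z₂.mem) := by
  obtain ⟨R, h⟩ := ZermeloAux.exists_isB Z₁ Z₂
  choose f hf using h.total
  choose g hg using h.swap.total
  have hfg : ∀ y, f (g y) = y := fun y => h.uniq (g y) _ _ (hf _) (hg y)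
  have hgf : ∀ x, g (f x) = x := fun x => h.swap.uniq (f x) _ _ (hg _) (hf x)
  refine ⟨⟨⟨f, g, hgf, hfg⟩, ?_⟩⟩
  intro a b
  change Z₂.mem (f a) (f b) ↔ Z₁.mem a b
  constructor
  · intro hab
    obtain ⟨t, ht, hta⟩ := ((h b (f b)).1 (hf b)).2 _ hab
    rw [h.swap.uniq (f a) a t (hf a) hta]
    exact ht
  · intro hab
    obtain ⟨s, hs, has⟩ := ((h b (f b)).1 (hf b)).1 _ hab
    rw [h.uniq a (f a) s (hf a) has]
    exact hs
end
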